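/- arXiv:1509.07464 — 2 statements merged into one kernel-verified Lean document; each statement's English description precedes it below -/
import Mathlib

section
/- (Magnetic Kato inequality, classical form.) Let Ω ⊂ ℝᴺ be open, ε > 0, A ∈ C¹(Ω,ℝᴺ), and let u ∈ C²(Ω,ℂ) satisfy u(x) ≠ 0 for all x ∈ Ω. Then |u| ∈ C²(Ω,ℝ) and for every x ∈ Ω one has ε²Δ|u|(x) ≥ −Re( (conj(u(x))/|u(x)|) · ((iε∇+A)²u)(x) ), where (iε∇+A)²u = −ε²Δu + 2iεA·∇u + iε(div A)u + |A|²u. -/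
open MeasureTheory Real Filter Topology Set

noncomputable section

/-- `N`-dimensional Euclidean space. -/
abbrev Eu (N : ℕ) := EuclideanSpace ℝ (Fin N)

/-- Build a point of `ℝ³` from coordinates. -/
def toE3 (a b c : ℝ) : Eu 3 := (WithLp.equiv 2 (Fin 3 → ℝ)).symm ![a, b, c]

/-- Build a point of `ℝ²` from coordinates. -/
def toE2 (a b : ℝ) : Eu 2 := (WithLp.equiv 2 (Fin 2 → ℝ)).symm ![a, b]

/-- `i`-th (classical) partial derivative of a complex-valued function. -/
def pdC {N : ℕ} (i : Fin N) (u : Eu N → ℂ) (x : Eu N) : ℂ :=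
  fderiv ℝ u x (EuclideanSpace.single i 1)

/-- `i`-th (classical) partial derivative of a real-valued function. -/
def pdR {N : ℕ} (i : Fin N) (f : Eu N → ℝ) (x : Eu N) : ℝ :=
  fderiv ℝ f x (EuclideanSpace.single i 1)

/-- classical Laplacian of a complex-valued function. -/
def lapC {N : ℕ} (u : Eu N → ℂ) (x : Eu N) : ℂ := ∑ i, pdC i (pdC i u) x

/-- classical Laplacian of a real-valued function. -/
def lapR {N : ℕ} (f : Eu N → ℝ) (x : Eu N) : ℝ := ∑ i, pdR i (pdR i f) x

/-- the `i`-th component of the magnetic gradient `(iε∇ + A)u`. -/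
def magGrad {N : ℕ} (ε : ℝ) (A : Eu N → Eu N) (u : Eu N → ℂ) (x : Eu N) (i : Fin N) : ℂ :=
  Complex.I * (ε : ℂ) * pdC i u x + (A x i : ℂ) * u x

/-- the magnetic Schrödinger operator
`(iε∇+A)²u = -ε²Δu + 2iεA·∇u + iε(div A)u + |A|²u` (classical rendering). -/
def magOp {N : ℕ} (ε : ℝ) (A : Eu N → Eu N) (u : Eu N → ℂ) (x : Eu N) : ℂ :=
  -(ε^2 : ℂ) * lapC u x + 2 * Complex.I * (ε : ℂ) * (∑ i, (A x i : ℂ) * pdC i u x)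
    + Complex.I * (ε : ℂ) * ((∑ i, pdR i (fun y => A y i) x : ℝ) : ℂ) * u x
    + ((‖A x‖ ^ 2 : ℝ) : ℂ) * u x

/-- real inner product of two complex numbers: `Re (conj a * b)`. -/
def reInner (a b : ℂ) : ℝ := ((starRingEnd ℂ) a * b).re

/-- smooth compactly supported (complex) test function. -/
def TestFun {N : ℕ} (φ : Eu N → ℂ) : Prop := ContDiff ℝ (⊤ : ℕ∞) φ ∧ HasCompactSupport φ

/-- smooth compactly supported (real) test function. -/
def TestFunR {N : ℕ} (φ : Eu N → ℝ) : Prop := ContDiff ℝ (⊤ : ℕ∞) φ ∧ HasCompactSupport φ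

/-! ### The two-dimensional limit problem -/

/-- admissible class (an `H¹ ∩ L^p` class rendered with classical derivatives)
for the limit functional. -/
def AdmLim (p : ℝ) (u : Eu 2 → ℂ) : Prop :=
  ContDiff ℝ 1 u ∧ Integrable (fun x => Complex.normSq (u x)) ∧
    Integrable (fun x => ∑ i, Complex.normSq (pdC i u x)) ∧
    Integrable (fun x => ‖u x‖ ^ p)

/-- the limit-problem functional `J^{A₀}_{a₀}`. -/
def Jlim (p : ℝ) (A₀ : Eu 2) (a₀ : ℝ) (u : Eu 2 → ℂ) : ℝ :=
  (1/2) * ∫ x, ((∑ i, Complex.normSq (magGrad 1 (fun _ => A₀) u x i))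
      + a₀ * Complex.normSq (u x)) - (1/p) * ∫ x, ‖u x‖ ^ p

/-- membership in the Nehari manifold `N^{A₀}_{a₀}`. -/
def OnNehari (p : ℝ) (A₀ : Eu 2) (a₀ : ℝ) (u : Eu 2 → ℂ) : Prop :=
  AdmLim p u ∧ u ≠ 0 ∧
    (∫ x, ((∑ i, Complex.normSq (magGrad 1 (fun _ => A₀) u x i))
        + a₀ * Complex.normSq (u x))) = ∫ x, ‖u x‖ ^ p

/-- the ground state energy `E(A₀,a₀)`: infimum of `J^{A₀}_{a₀}` on the Nehari manifold. -/
def groundEnergy (p : ℝ) (A₀ : Eu 2) (a₀ : ℝ) : ℝ :=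
  sInf {e | ∃ u, OnNehari p A₀ a₀ u ∧ e = Jlim p A₀ a₀ u}

/-- weak solution of the 2D limit equation `(i∇+A₀)²u + a₀ u = |u|^{p-2}u`. -/
def IsWeakSol2 (p : ℝ) (A₀ : Eu 2) (a₀ : ℝ) (u : Eu 2 → ℂ) : Prop :=
  ∀ φ : Eu 2 → ℂ, TestFun φ →
    (∫ x, ((∑ i, reInner (magGrad 1 (fun _ => A₀) φ x i) (magGrad 1 (fun _ => A₀) u x i))
       + a₀ * reInner (φ x) (u x)))
      = ∫ x, ‖u x‖ ^ (p-2) * reInner (φ x) (u x)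

/-! ### Cylindrical geometry in `ℝ³` -/

/-- distance to the `x₃`-axis. -/
def rad (x : Eu 3) : ℝ := Real.sqrt (x 0 ^ 2 + x 1 ^ 2)

/-- cylindrical pseudometric. -/
def dcyl (y z : Eu 3) : ℝ := Real.sqrt ((rad y - rad z) ^ 2 + (y 2 - z 2) ^ 2)

/-- cylindrical distance from a point to a set. -/
def dcylSet (x : Eu 3) (S : Set (Eu 3)) : ℝ := sInf (dcyl x '' S)

/-- the element `g_α` (rotation by `α` around the `x₃` axis composed with `x₃ ↦ s x₃`,
`s = ±1`) of the symmetry group `G`. -/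
def gAct (α s : ℝ) (x : Eu 3) : Eu 3 :=
  toE3 (Real.cos α * x 0 - Real.sin α * x 1) (Real.sin α * x 0 + Real.cos α * x 1) (s * x 2)

/-- a function on `ℝ³` is `G`-invariant. -/
def GInvFun {β : Type*} (u : Eu 3 → β) : Prop :=
  ∀ α s : ℝ, s = 1 ∨ s = -1 → ∀ x, u (gAct α s x) = u x

/-- a subset of `ℝ³` is `G`-invariant. -/
def GInvSet (Λ : Set (Eu 3)) : Prop :=
  ∀ α s : ℝ, s = 1 ∨ s = -1 → gAct α s '' Λ = Λ

/-- a vector field on `ℝ³` is `G`-equivariant: `g A(g⁻¹ x) = A(x)` for all `g ∈ G`. -/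
def GEquiv (A : Eu 3 → Eu 3) : Prop :=
  ∀ α s : ℝ, s = 1 ∨ s = -1 → ∀ x, gAct α s (A (gAct (-α) s x)) = A x

/-- the `x₃`-axis `𝓗`. -/
def axisH : Set (Eu 3) := {x | x 0 = 0 ∧ x 1 = 0}

/-- the plane `𝓗⊥ = {x₃ = 0}`. -/
def planeHperp : Set (Eu 3) := {x | x 2 = 0}

/-- the tangential component `c = A · e_τ` of a vector field,
where `e_τ = (-x₂/ρ, x₁/ρ, 0)`. -/
def tangComp (A : Eu 3 → Eu 3) (x : Eu 3) : ℝ :=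
  (-(x 1) * A x 0 + x 0 * A x 1) / rad x

/-- the concentration function `M = 2πρ (c² + V)^{2/(p-2)} E(0,1)` (with `E01 = E(0,1)`). -/
def concFun (p E01 : ℝ) (A : Eu 3 → Eu 3) (V : Eu 3 → ℝ) (x : Eu 3) : ℝ :=
  2 * π * rad x * (tangComp A x ^ 2 + V x) ^ ((2:ℝ) / (p - 2)) * E01

/-- weak solution of `(iε∇+A)²u + Vu = |u|^{p-2}u` in `ℝ³`. -/
def IsWeakSol3 (ε : ℝ) (A : Eu 3 → Eu 3) (V : Eu 3 → ℝ) (p : ℝ) (u : Eu 3 → ℂ) : Prop :=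
  ∀ φ : Eu 3 → ℂ, TestFun φ →
    (∫ x, ((∑ i, reInner (magGrad ε A φ x i) (magGrad ε A u x i))
        + V x * reInner (φ x) (u x)))
      = ∫ x, ‖u x‖ ^ (p - 2) * reInner (φ x) (u x)

/-! ### The penalization scheme -/

/-- Hardy-type auxiliary potential `H(x) = κ/(|x|²((log|x|)²+1)^{(1+β)/2})`. -/
def Hpot {N : ℕ} (κ β : ℝ) (x : Eu N) : ℝ :=
  κ / (‖x‖ ^ 2 * ((Real.log ‖x‖) ^ 2 + 1) ^ ((1 + β) / 2))

/-- the nonlinearity `f(s) = s^{(p-2)/2}`. -/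
def fpow (p s : ℝ) : ℝ := s ^ ((p - 2)/2)

open Classical in
/-- the penalized nonlinearity `g_ε`. -/
def gpen (p μ κ β ε : ℝ) (Λ : Set (Eu 3)) (V : Eu 3 → ℝ) (x : Eu 3) (s : ℝ) : ℝ :=
  if x ∈ Λ then fpow p s else min (ε ^ 2 * Hpot κ β x + μ * V x) (fpow p s)

/-- its primitive `G_ε(x,s) = ½∫₀ˢ g_ε(x,σ)dσ`. -/
def Gpen (p μ κ β ε : ℝ) (Λ : Set (Eu 3)) (V : Eu 3 → ℝ) (x : Eu 3) (s : ℝ) : ℝ :=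
  (1/2) * ∫ σ in (0:ℝ)..s, gpen p μ κ β ε Λ V x σ

/-- the squared norm `‖u‖_ε² = ∫ |(iε∇+A)u|² + V|u|²`. -/
def enSq (ε : ℝ) (A : Eu 3 → Eu 3) (V : Eu 3 → ℝ) (u : Eu 3 → ℂ) : ℝ :=
  ∫ x, ((∑ i, Complex.normSq (magGrad ε A u x i)) + V x * Complex.normSq (u x))

/-- membership in `X_ε` (the `G`-invariant magnetic Sobolev class, classical rendering). -/
def MemX (ε : ℝ) (A : Eu 3 → Eu 3) (V : Eu 3 → ℝ) (u : Eu 3 → ℂ) : Prop :=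
  Differentiable ℝ u ∧
    Integrable (fun x => ∑ i, Complex.normSq (magGrad ε A u x i)) ∧
    Integrable (fun x => V x * Complex.normSq (u x)) ∧
    GInvFun u

/-- the penalized functional `J_ε`. -/
def Jpen (p μ κ β ε : ℝ) (Λ : Set (Eu 3)) (A : Eu 3 → Eu 3) (V : Eu 3 → ℝ)
    (u : Eu 3 → ℂ) : ℝ :=
  (1/2) * enSq ε A V u - ∫ x, Gpen p μ κ β ε Λ V x (Complex.normSq (u x))

/-- the Gateaux derivative pairing `⟨J_ε'(u), v⟩`. -/
def JpenD (p μ κ β ε : ℝ) (Λ : Set (Eu 3)) (A : Eu 3 → Eu 3) (V : Eu 3 → ℝ)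
    (u v : Eu 3 → ℂ) : ℝ :=
  ∫ x, ((∑ i, reInner (magGrad ε A v x i) (magGrad ε A u x i))
      + V x * reInner (v x) (u x)
      - gpen p μ κ β ε Λ V x (Complex.normSq (u x)) * reInner (v x) (u x))

/-- the mountain-pass level `c_ε = inf_{u ∈ X_ε \ {0}} sup_{t>0} J_ε(tu)`. -/
def mpLevel (p μ κ β ε : ℝ) (Λ : Set (Eu 3)) (A : Eu 3 → Eu 3) (V : Eu 3 → ℝ) : ℝ :=
  sInf {e | ∃ u, MemX ε A V u ∧ u ≠ 0 ∧
    e = sSup {a | ∃ t : ℝ, 0 < t ∧ a = Jpen p μ κ β ε Λ A V (fun x => (t : ℂ) * u x)}}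

/-- mountain-pass solution of the penalized problem at level `c_ε`. -/
def IsMPSol (p μ κ β ε : ℝ) (Λ : Set (Eu 3)) (A : Eu 3 → Eu 3) (V : Eu 3 → ℝ)
    (u : Eu 3 → ℂ) : Prop :=
  MemX ε A V u ∧ u ≠ 0 ∧ (∀ v, MemX ε A V v → JpenD p μ κ β ε Λ A V u v = 0) ∧
    Jpen p μ κ β ε Λ A V u = mpLevel p μ κ β ε Λ A V

/-- curl of a vector field on `ℝ³` (classical). -/
def curl3 (A : Eu 3 → Eu 3) (x : Eu 3) : Eu 3 :=
  toE3 (pdR 1 (fun y => A y 2) x - pdR 2 (fun y => A y 1) x)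
       (pdR 2 (fun y => A y 0) x - pdR 0 (fun y => A y 2) x)
       (pdR 0 (fun y => A y 1) x - pdR 1 (fun y => A y 0) x)

/-- the vortex phase `((x₂ + i x₁)/ρ)^k`. -/
def vortexPhase (k : ℤ) (x : Eu 3) : ℂ :=
  ((x 1 : ℂ) + Complex.I * (x 0 : ℂ)) ^ k / (rad x : ℂ) ^ k


lemma norm_mul_pdR_norm {N : ℕ} (i : Fin N) {u : Eu N → ℂ} {x : Eu N}
    (hu : DifferentiableAt ℝ u x) (hx : u x ≠ 0) :
    ‖u x‖ * pdR i (fun y => ‖u y‖) x = inner ℝ (u x) (pdC i u x) := by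
  have hg : DifferentiableAt ℝ (fun y => ‖u y‖) x := hu.norm ℝ hx
  have h := fderiv_inner_apply ℝ hu hu (EuclideanSpace.single i 1)
  simp_rw [real_inner_self_eq_norm_mul_norm] at h
  rw [fderiv_fun_mul hg hg, real_inner_comm (u x)] at h
  simp only [add_apply, smul_apply, smul_eq_mul] at h
  unfold pdR pdC
  linarith

lemma differentiableAt_fderiv_apply {E F : Type*} [NormedAddCommGroup E] [NormedSpace ℝ E]
    [NormedAddCommGroup F] [NormedSpace ℝ F] {f : E → F} {x : E} (hf : ContDiffAt ℝ 2 f x)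
    (v : E) : DifferentiableAt ℝ (fun y => fderiv ℝ f y v) x :=
  ((hf.fderiv_right (m := 1) (by norm_num)).differentiableAt (by norm_num)).clm_apply
    (differentiableAt_const v)

lemma norm_mul_pdR_pdR_norm {N : ℕ} (i : Fin N) {u : Eu N → ℂ} {x : Eu N}
    (hu : ContDiffAt ℝ 2 u x) (hx : u x ≠ 0) :
    pdR i (fun y => ‖u y‖) x ^ 2 + ‖u x‖ * pdR i (pdR i (fun y => ‖u y‖)) x =
      ‖pdC i u x‖ ^ 2 + inner ℝ (u x) (pdC i (pdC i u) x) := by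
  have hg : ContDiffAt ℝ 2 (fun y => ‖u y‖) x := hu.norm ℝ hx
  have hud : DifferentiableAt ℝ u x := hu.differentiableAt (by norm_num)
  have hgd : DifferentiableAt ℝ (fun y => ‖u y‖) x := hg.differentiableAt (by norm_num)
  have hu' : DifferentiableAt ℝ (pdC i u) x := differentiableAt_fderiv_apply hu _
  have hg' : DifferentiableAt ℝ (pdR i fun y => ‖u y‖) x := differentiableAt_fderiv_apply hg _
  have heq : (fun y => ‖u y‖ * pdR i (fun y => ‖u y‖) y) =ᶠ[𝓝 x]
      fun y => inner ℝ (u y) (pdC i u y) := by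
    filter_upwards [hu.eventually (by simp), hu.continuousAt.eventually_ne hx] with y hy hy0
    exact norm_mul_pdR_norm i (hy.differentiableAt (by norm_num)) hy0
  have h := congrArg (fun L : Eu N →L[ℝ] ℝ => L (EuclideanSpace.single i 1)) heq.fderiv_eq
  simp only [fderiv_inner_apply ℝ hud hu', fderiv_fun_mul hgd hg',
    add_apply, smul_apply, smul_eq_mul] at h
  change ‖u x‖ * pdR i (pdR i fun y => ‖u y‖) x
    + pdR i (fun y => ‖u y‖) x * pdR i (fun y => ‖u y‖) x
    = inner ℝ (u x) (pdC i (pdC i u) x) + inner ℝ (pdC i u x) (pdC i u x) at h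
  rw [real_inner_self_eq_norm_sq] at h
  linarith

/-- Pointwise form of the Kato inequality in one coordinate direction: `p` and `s` stand for the
first and second derivatives of `z`, and `g₁`, `g₂` for those of `‖z‖`. -/
lemma magnetic_kato_coordinate (ε a g₁ g₂ : ℝ) {z p s : ℂ} (hz : z ≠ 0)
    (h₁ : ‖z‖ * g₁ = inner ℝ z p) (h₂ : g₁ ^ 2 + ‖z‖ * g₂ = ‖p‖ ^ 2 + inner ℝ z s) :
    ε ^ 2 * (inner ℝ z s : ℝ) + 2 * ε * a * ((starRingEnd ℂ) z * p).im - a ^ 2 * ‖z‖ ^ 2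
      ≤ ε ^ 2 * (‖z‖ * g₂) := by
  have hg : 0 < ‖z‖ ^ 2 := by positivity
  have key : ‖z‖ ^ 2 * ‖p‖ ^ 2 = (‖z‖ * g₁) ^ 2 + ((starRingEnd ℂ) z * p).im ^ 2 := by
    rw [h₁, Complex.inner, mul_comm p, ← mul_pow, ← Complex.norm_conj z, ← norm_mul,
      ← Complex.normSq_eq_norm_sq, Complex.normSq_apply]
    ring
  have hs : (inner ℝ z s : ℝ) = g₁ ^ 2 + ‖z‖ * g₂ - ‖p‖ ^ 2 := by linarith
  rw [hs]
  refine le_of_mul_le_mul_left ?_ hg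
  nlinarith [sq_nonneg (ε * ((starRingEnd ℂ) z * p).im - a * ‖z‖ ^ 2),
    congrArg (ε ^ 2 * ·) key]

lemma re_conj_mul_magOp {N : ℕ} (ε : ℝ) (A : Eu N → Eu N) (u : Eu N → ℂ) (x : Eu N) :
    ((starRingEnd ℂ) (u x) * magOp ε A u x).re =
      -∑ i, (ε ^ 2 * (inner ℝ (u x) (pdC i (pdC i u) x) : ℝ)
        + 2 * ε * A x i * ((starRingEnd ℂ) (u x) * pdC i u x).im - A x i ^ 2 * ‖u x‖ ^ 2) := by
  have hA : ‖A x‖ ^ 2 = ∑ i, A x i ^ 2 := by simp [EuclideanSpace.norm_sq_eq]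
  have hlap : ∑ i, (inner ℝ (u x) (pdC i (pdC i u) x) : ℝ)
      = ((starRingEnd ℂ) (u x) * lapC u x).re := by
    rw [← inner_sum, Complex.inner, mul_comm, lapC]
  have hgrad : ∑ i, A x i * ((starRingEnd ℂ) (u x) * pdC i u x).im
      = ((starRingEnd ℂ) (u x) * ∑ i, (A x i : ℂ) * pdC i u x).im := by
    rw [Finset.mul_sum, Complex.im_sum]
    refine Finset.sum_congr rfl fun i _ => ?_
    rw [mul_left_comm, Complex.im_ofReal_mul]
  simp only [Finset.sum_sub_distrib, Finset.sum_add_distrib, mul_assoc, ← Finset.mul_sum,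
    ← Finset.sum_mul]
  rw [hlap, hgrad, ← hA, ← Complex.normSq_eq_norm_sq (u x), Complex.normSq_apply, magOp]
  simp only [← Complex.ofReal_pow, Complex.mul_re, Complex.mul_im, Complex.add_re, Complex.add_im,
    Complex.neg_re, Complex.neg_im, Complex.conj_re, Complex.conj_im, Complex.ofReal_re,
    Complex.ofReal_im, Complex.I_re, Complex.I_im, Complex.re_ofNat, Complex.im_ofNat]
  ring

/-- magnetic Kato inequality, classical form: for `u ∈ C²(Ω,ℂ)`
nonvanishing on the open set `Ω` and `A ∈ C¹(Ω,ℝᴺ)`, the modulus `|u|` is `C²` on `Ω`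
and `ε²Δ|u| ≥ −Re((conj u/|u|)(iε∇+A)²u)` on `Ω`. -/
theorem magnetic_kato (N : ℕ) (Ω : Set (Eu N)) (hΩ : IsOpen Ω) (ε : ℝ) (hε : 0 < ε)
    (A : Eu N → Eu N) (hA : ContDiffOn ℝ 1 A Ω)
    (u : Eu N → ℂ) (hu : ContDiffOn ℝ 2 u Ω) (hu0 : ∀ x ∈ Ω, u x ≠ 0) :
    ContDiffOn ℝ 2 (fun y => ‖u y‖) Ω ∧
    ∀ x ∈ Ω, -(((starRingEnd ℂ) (u x) / ((‖u x‖ : ℝ) : ℂ)) * magOp ε A u x).re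
        ≤ ε ^ 2 * lapR (fun y => ‖u y‖) x := by
  have hC (x : Eu N) (hx : x ∈ Ω) : ContDiffAt ℝ 2 u x := hu.contDiffAt (hΩ.mem_nhds hx)
  refine ⟨fun x hx => ((hC x hx).norm ℝ (hu0 x hx)).contDiffWithinAt, fun x hx => ?_⟩
  have hz := hu0 x hx
  have hg : 0 < ‖u x‖ := norm_pos_iff.mpr hz
  rw [div_mul_eq_mul_div, Complex.div_ofReal_re, re_conj_mul_magOp, neg_div, neg_neg,
    div_le_iff₀ hg, lapR, Finset.mul_sum, Finset.sum_mul]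
  refine Finset.sum_le_sum fun i _ => ?_
  have h := magnetic_kato_coordinate ε (A x i) _ _ hz
    (norm_mul_pdR_norm i ((hC x hx).differentiableAt (by norm_num)) hz)
    (norm_mul_pdR_pdR_norm i (hC x hx) hz)
  linarith

end
end

section
/- (Vortex ansatz reduction.) Let p > 2, ε > 0, k ∈ ℤ, C_k ∈ ℝ\{0}, and suppose the magnetic potential has the form A(ρ,θ,x₃) = c(ρ)(−sin θ, cos θ, 0) in cylindrical coordinates, with V = V(ρ,x₃). For a real cylindrically symmetric function v_k on ℝ³ (depending only on ρ and x₃), define u_k(x) = C_k ((x₂+ix₁)/ρ)^k v_k(x) on ℝ³ off the x₃-axis. Then u_k solves (iε∇+A)²u + V(ρ,x₃)u = |u|^{p−2}u if and only if v_k is a real solution of −ε²Δv_k + ( (kε/ρ + c(ρ))² + V(ρ,x₃) ) v_k = C_k^{p−2} |v_k|^{p−2} v_k. -/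
open MeasureTheory Real Filter Topology Set

noncomputable section

lemma rad_sq (x : Eu 3) : rad x ^ 2 = x 0 ^ 2 + x 1 ^ 2 :=
  Real.sq_sqrt (by positivity)

lemma continuous_rad : Continuous rad := by
  unfold rad; fun_prop

lemma isOpen_rad_ne_zero : IsOpen {x : Eu 3 | rad x ≠ 0} :=
  isOpen_ne_fun continuous_rad continuous_const

lemma rad_ne_zero_eventually {x : Eu 3} (hx : rad x ≠ 0) : ∀ᶠ y in 𝓝 x, rad y ≠ 0 :=
  isOpen_rad_ne_zero.mem_nhds hx

lemma hasFDerivAt_coord {N : ℕ} (i : Fin N) (x : Eu N) :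
    HasFDerivAt (fun y : Eu N => y i) (EuclideanSpace.proj i : Eu N →L[ℝ] ℝ) x :=
  (EuclideanSpace.proj i : Eu N →L[ℝ] ℝ).hasFDerivAt

lemma hasFDerivAt_rad {x : Eu 3} (hx : rad x ≠ 0) :
    HasFDerivAt rad ((rad x)⁻¹ • (x 0 • (EuclideanSpace.proj 0 : Eu 3 →L[ℝ] ℝ)
      + x 1 • (EuclideanSpace.proj 1 : Eu 3 →L[ℝ] ℝ))) x := by
  have h0 : x 0 ^ 2 + x 1 ^ 2 ≠ 0 := by rw [← rad_sq]; exact pow_ne_zero 2 hx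
  have h := (((hasFDerivAt_coord 0 x).pow 2).add ((hasFDerivAt_coord 1 x).pow 2)).sqrt h0
  refine h.congr_fderiv ?_
  ext e
  simp only [rad] at hx ⊢
  simp
  field_simp

lemma pdR_rad {x : Eu 3} (hx : rad x ≠ 0) :
    pdR 0 rad x = x 0 / rad x ∧ pdR 1 rad x = x 1 / rad x ∧ pdR 2 rad x = 0 := by
  simp only [pdR, (hasFDerivAt_rad hx).fderiv]
  simp [div_eq_inv_mul]

lemma pdR_coord {N : ℕ} (i j : Fin N) (x : Eu N) :
    pdR i (fun y => y j) x = if i = j then 1 else 0 := by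
  simp [pdR, (hasFDerivAt_coord j x).fderiv, eq_comm]

lemma pdR_mul {N : ℕ} {i : Fin N} {f g : Eu N → ℝ} {x : Eu N}
    (hf : DifferentiableAt ℝ f x) (hg : DifferentiableAt ℝ g x) :
    pdR i (fun y => f y * g y) x = f x * pdR i g x + pdR i f x * g x := by
  simp only [pdR, fderiv_fun_mul hf hg]
  simp [mul_comm]

lemma pdR_comp {N : ℕ} {i : Fin N} {g : ℝ → ℝ} {f : Eu N → ℝ} {x : Eu N}
    (hg : DifferentiableAt ℝ g (f x)) (hf : DifferentiableAt ℝ f x) :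
    pdR i (fun y => g (f y)) x = deriv g (f x) * pdR i f x := by
  have h := (hg.hasDerivAt.comp_hasFDerivAt x hf.hasFDerivAt).fderiv
  simp only [Function.comp_def] at h
  simp [pdR, h]

lemma pdC_mul {N : ℕ} {i : Fin N} {f g : Eu N → ℂ} {x : Eu N}
    (hf : DifferentiableAt ℝ f x) (hg : DifferentiableAt ℝ g x) :
    pdC i (fun y => f y * g y) x = f x * pdC i g x + pdC i f x * g x := by
  simp only [pdC, fderiv_fun_mul hf hg]
  simp [mul_comm]

lemma pdC_add {N : ℕ} {i : Fin N} {f g : Eu N → ℂ} {x : Eu N}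
    (hf : DifferentiableAt ℝ f x) (hg : DifferentiableAt ℝ g x) :
    pdC i (fun y => f y + g y) x = pdC i f x + pdC i g x := by
  simp [pdC, fderiv_fun_add hf hg]

lemma pdC_const_mul {N : ℕ} {i : Fin N} (a : ℂ) {f : Eu N → ℂ} {x : Eu N}
    (hf : DifferentiableAt ℝ f x) :
    pdC i (fun y => a * f y) x = a * pdC i f x := by
  simp [pdC, fderiv_const_mul hf]

lemma DifferentiableAt.complex_ofReal {N : ℕ} {f : Eu N → ℝ} {x : Eu N}
    (hf : DifferentiableAt ℝ f x) : DifferentiableAt ℝ (fun y => (f y : ℂ)) x :=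
  Complex.ofRealCLM.differentiableAt.comp x hf

lemma pdC_ofReal {N : ℕ} {i : Fin N} {f : Eu N → ℝ} {x : Eu N}
    (hf : DifferentiableAt ℝ f x) :
    pdC i (fun y => (f y : ℂ)) x = (pdR i f x : ℂ) := by
  have h := (Complex.ofRealCLM.hasFDerivAt.comp x hf.hasFDerivAt).fderiv
  simp only [Function.comp_def, Complex.ofRealCLM_apply] at h
  simp [pdC, pdR, h]

lemma pdC_congr {N : ℕ} {i : Fin N} {f g : Eu N → ℂ} {x : Eu N} (h : f =ᶠ[𝓝 x] g) :
    pdC i f x = pdC i g x := by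
  simp [pdC, h.fderiv_eq]

/-- The partial derivatives of the vortex phase are `i` times these coefficients times the
phase itself. -/
def phaseGrad (k : ℤ) (i : Fin 3) (x : Eu 3) : ℝ :=
  k * ![x 1, -x 0, 0] i * (rad x ^ 2)⁻¹

lemma axis_complex_ne_zero {x : Eu 3} (hx : rad x ≠ 0) :
    (x 1 : ℂ) + Complex.I * (x 0 : ℂ) ≠ 0 := by
  intro h
  have h0 := congrArg Complex.re h
  have h1 := congrArg Complex.im h
  simp at h0 h1
  exact hx (by simp [rad, h0, h1])

lemma norm_axis_complex (x : Eu 3) : ‖(x 1 : ℂ) + Complex.I * (x 0 : ℂ)‖ = rad x := by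
  rw [mul_comm, Complex.norm_add_mul_I, rad, add_comm]

lemma norm_vortexPhase (k : ℤ) {x : Eu 3} (hx : rad x ≠ 0) : ‖vortexPhase k x‖ = 1 := by
  have h : ‖(rad x : ℂ)‖ = rad x := by
    rw [Complex.norm_real]
    exact Real.norm_of_nonneg (Real.sqrt_nonneg _)
  rw [vortexPhase, norm_div, norm_zpow, norm_zpow, norm_axis_complex, h]
  exact div_self (zpow_ne_zero k hx)

lemma vortexPhase_ne_zero (k : ℤ) {x : Eu 3} (hx : rad x ≠ 0) : vortexPhase k x ≠ 0 := by
  rw [← norm_ne_zero_iff, norm_vortexPhase k hx]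
  exact one_ne_zero

lemma differentiableAt_rad {x : Eu 3} (hx : rad x ≠ 0) : DifferentiableAt ℝ rad x :=
  (hasFDerivAt_rad hx).differentiableAt

lemma pdC_zpow {N : ℕ} {i : Fin N} (k : ℤ) {f : Eu N → ℂ} {x : Eu N}
    (hf : DifferentiableAt ℝ f x) (hx : f x ≠ 0) :
    pdC i (fun y => f y ^ k) x = k * f x ^ k * (f x)⁻¹ * pdC i f x := by
  have h := ((hasDerivAt_zpow k (f x) (Or.inl hx)).comp_hasFDerivAt_of_eq x
    hf.hasFDerivAt rfl).fderiv
  simp only [Function.comp_def] at h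
  simp [pdC, h, zpow_sub_one₀ hx, mul_assoc]

lemma vortexPhase_eq (k : ℤ) : vortexPhase k =
    fun x => ((x 1 : ℂ) + Complex.I * (x 0 : ℂ)) ^ k * (rad x : ℂ) ^ (-k) := by
  ext x
  rw [vortexPhase, zpow_neg, div_eq_mul_inv]

lemma DifferentiableAt.complex_zpow {N : ℕ} (k : ℤ) {f : Eu N → ℂ} {x : Eu N}
    (hf : DifferentiableAt ℝ f x) (hx : f x ≠ 0) :
    DifferentiableAt ℝ (fun y => f y ^ k) x :=
  ((hasDerivAt_zpow k (f x) (Or.inl hx)).comp_hasFDerivAt_of_eq x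
    hf.hasFDerivAt rfl).differentiableAt

lemma differentiableAt_coord_ofReal {N : ℕ} (i : Fin N) (x : Eu N) :
    DifferentiableAt ℝ (fun y : Eu N => (y i : ℂ)) x :=
  (hasFDerivAt_coord i x).differentiableAt.complex_ofReal

lemma differentiableAt_axis_complex (x : Eu 3) :
    DifferentiableAt ℝ (fun y : Eu 3 => (y 1 : ℂ) + Complex.I * (y 0 : ℂ)) x :=
  (differentiableAt_coord_ofReal 1 x).add ((differentiableAt_coord_ofReal 0 x).const_mul _)

lemma differentiableAt_vortexPhase (k : ℤ) {x : Eu 3} (hx : rad x ≠ 0) :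
    DifferentiableAt ℝ (vortexPhase k) x := by
  rw [vortexPhase_eq]
  exact ((differentiableAt_axis_complex x).complex_zpow k (axis_complex_ne_zero hx)).mul
    ((differentiableAt_rad hx).complex_ofReal.complex_zpow (-k) (Complex.ofReal_ne_zero.2 hx))

lemma pdC_vortexPhase (k : ℤ) (i : Fin 3) {x : Eu 3} (hx : rad x ≠ 0) :
    pdC i (vortexPhase k) x = vortexPhase k x * (Complex.I * (phaseGrad k i x : ℂ)) := by
  have hz := axis_complex_ne_zero hx
  have hr : (rad x : ℂ) ≠ 0 := Complex.ofReal_ne_zero.2 hx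
  have hsq : (rad x : ℂ) ^ 2 = (x 0 : ℂ) ^ 2 + (x 1 : ℂ) ^ 2 := by exact_mod_cast rad_sq x
  have hdr := (differentiableAt_rad hx).complex_ofReal
  obtain ⟨h0, h1, h2⟩ := pdR_rad hx
  rw [vortexPhase_eq, pdC_mul ((differentiableAt_axis_complex x).complex_zpow k hz)
    (hdr.complex_zpow (-k) hr), pdC_zpow k (differentiableAt_axis_complex x) hz,
    pdC_zpow (-k) hdr hr, pdC_ofReal (differentiableAt_rad hx),
    pdC_add (differentiableAt_coord_ofReal 1 x)
      ((differentiableAt_coord_ofReal 0 x).const_mul _),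
    pdC_const_mul _ (differentiableAt_coord_ofReal 0 x),
    pdC_ofReal (hasFDerivAt_coord 0 x).differentiableAt,
    pdC_ofReal (hasFDerivAt_coord 1 x).differentiableAt, pdR_coord, pdR_coord]
  dsimp only
  have key : ∀ a b c : ℂ, c = ((x 1 : ℂ) + Complex.I * (x 0 : ℂ))⁻¹ * a - (rad x : ℂ)⁻¹ * b →
      ((x 1 : ℂ) + Complex.I * (x 0 : ℂ)) ^ k
        * (((-k : ℤ) : ℂ) * (rad x : ℂ) ^ (-k) * (rad x : ℂ)⁻¹ * b)
      + (k * ((x 1 : ℂ) + Complex.I * (x 0 : ℂ)) ^ k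
          * ((x 1 : ℂ) + Complex.I * (x 0 : ℂ))⁻¹ * a) * (rad x : ℂ) ^ (-k)
      = ((x 1 : ℂ) + Complex.I * (x 0 : ℂ)) ^ k * (rad x : ℂ) ^ (-k) * (k * c) := by
    rintro a b c rfl
    push_cast
    ring
  have hI := Complex.I_sq
  have hinv : ((x 1 : ℂ) + Complex.I * (x 0 : ℂ))⁻¹
      = ((x 1 : ℂ) - Complex.I * (x 0 : ℂ)) * ((rad x : ℂ) ^ 2)⁻¹ := by
    field_simp
    linear_combination hsq + (x 0 : ℂ) ^ 2 * hI
  rw [key _ _ (Complex.I * (![x 1, -x 0, 0] i : ℝ) * ((rad x : ℂ) ^ 2)⁻¹)]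
  · simp only [phaseGrad]
    push_cast
    ring
  · rw [hinv]
    fin_cases i
    · simp [h0]
      field_simp
      linear_combination (x 0 : ℂ) * hI
    · simp [h1]
      field_simp
      ring
    · simp [h2]

lemma differentiableAt_tangential (i : Fin 3) (x : Eu 3) :
    DifferentiableAt ℝ (fun y : Eu 3 => (![y 1, -y 0, 0] i : ℝ)) x := by
  fin_cases i
  · exact (hasFDerivAt_coord 1 x).differentiableAt
  · exact (hasFDerivAt_coord 0 x).differentiableAt.neg
  · exact differentiableAt_const _

/-- A radial function times the tangential field is divergence free. -/
lemma div_radial_tangential {g : ℝ → ℝ} {x : Eu 3} (hx : rad x ≠ 0)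
    (hg : DifferentiableAt ℝ g (rad x)) :
    ∑ i, pdR i (fun y : Eu 3 => (![y 1, -y 0, 0] i : ℝ) * g (rad y)) x = 0 := by
  have hr := differentiableAt_rad hx
  have hgr : DifferentiableAt ℝ (fun y => g (rad y)) x := hg.comp x hr
  obtain ⟨h0, h1, h2⟩ := pdR_rad hx
  have hneg : pdR 1 (fun y : Eu 3 => -y 0) x = 0 := by
    simpa [pdR] using pdR_coord 1 0 x
  have hzero : pdR 2 (fun _ : Eu 3 => (0 : ℝ)) x = 0 := by simp [pdR]
  simp only [pdR_mul (differentiableAt_tangential _ x) hgr, pdR_comp hg hr, Fin.sum_univ_three]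
  simp [h0, h1, h2, hneg, hzero, pdR_coord]
  ring

lemma differentiableAt_phaseGrad (k : ℤ) (i : Fin 3) {x : Eu 3} (hx : rad x ≠ 0) :
    DifferentiableAt ℝ (phaseGrad k i) x :=
  ((differentiableAt_tangential i x).const_mul _).mul
    (((differentiableAt_rad hx).pow 2).fun_inv (pow_ne_zero 2 hx))

lemma div_phaseGrad (k : ℤ) {x : Eu 3} (hx : rad x ≠ 0) :
    ∑ i, pdR i (phaseGrad k i) x = 0 := by
  have hsq : DifferentiableAt ℝ (fun t : ℝ => t ^ 2) (rad x) := differentiableAt_pow 2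
  have hg : DifferentiableAt ℝ (fun t : ℝ => k * (t ^ 2)⁻¹) (rad x) :=
    (hsq.fun_inv (pow_ne_zero 2 hx)).const_mul _
  rw [← div_radial_tangential hx hg]
  refine Finset.sum_congr rfl fun i _ => ?_
  congr 1
  ext y
  simp only [phaseGrad]
  ring

lemma sum_phaseGrad_sq (k : ℤ) {x : Eu 3} (hx : rad x ≠ 0) :
    ∑ i, phaseGrad k i x ^ 2 = (k / rad x) ^ 2 := by
  simp only [phaseGrad, Fin.sum_univ_three]
  simp
  field_simp
  rw [rad_sq]
  ring

/-- The angular derivative of a cylindrically symmetric function vanishes. -/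
lemma angular_deriv_eq_zero {v : Eu 3 → ℝ}
    (hvcyl : ∀ x y : Eu 3, rad x = rad y → x 2 = y 2 → v x = v y) {x : Eu 3}
    (hv : DifferentiableAt ℝ v x) : x 1 * pdR 0 v x - x 0 * pdR 1 v x = 0 := by
  let γ : ℝ → Eu 3 := fun t =>
    Real.cos t • x + Real.sin t • (x 1 • EuclideanSpace.single 0 1 - x 0 • EuclideanSpace.single 1 1)
      + (1 - Real.cos t) • (x 2 • EuclideanSpace.single 2 1)
  have hγ0 : γ 0 = x := by simp [γ]
  have hγ : HasDerivAt γ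
      (x 1 • EuclideanSpace.single 0 1 - x 0 • EuclideanSpace.single 1 1) 0 := by
    have h := (((Real.hasDerivAt_cos 0).smul_const x).add ((Real.hasDerivAt_sin 0).smul_const
      (x 1 • EuclideanSpace.single (0 : Fin 3) (1 : ℝ) - x 0 • EuclideanSpace.single 1 1))).add
      (((Real.hasDerivAt_cos 0).const_sub 1).smul_const
        (x 2 • EuclideanSpace.single (2 : Fin 3) (1 : ℝ)))
    refine h.congr_deriv ?_
    simp
  have hconst : (fun t => v (γ t)) = fun _ => v x := by
    ext t
    refine hvcyl _ _ ?_ ?_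
    · simp only [rad]
      congr 1
      simp [γ]
      linear_combination (x 0 ^ 2 + x 1 ^ 2) * Real.sin_sq_add_cos_sq t
    · simp [γ]
      ring
  have hv' : HasFDerivAt v (fderiv ℝ v x) (γ 0) := by rw [hγ0]; exact hv.hasFDerivAt
  have h := (hv'.comp_hasDerivAt 0 hγ).deriv
  simp only [Function.comp_def, hconst, deriv_const] at h
  simpa [pdR] using h.symm

lemma sum_phaseGrad_mul_pdR (k : ℤ) {v : Eu 3 → ℝ}
    (hvcyl : ∀ x y : Eu 3, rad x = rad y → x 2 = y 2 → v x = v y) {x : Eu 3}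
    (hv : DifferentiableAt ℝ v x) : ∑ i, phaseGrad k i x * pdR i v x = 0 := by
  simp only [phaseGrad, Fin.sum_univ_three]
  simp
  linear_combination (k * (rad x ^ 2)⁻¹) * angular_deriv_eq_zero hvcyl hv

lemma differentiableAt_pdR {v : Eu 3 → ℝ} {s : Set (Eu 3)} (hs : IsOpen s)
    (hv : ContDiffOn ℝ 2 v s) (i : Fin 3) {x : Eu 3} (hx : x ∈ s) :
    DifferentiableAt ℝ (pdR i v) x := by
  have h := (hv.fderiv_of_isOpen hs (m := 1) (by norm_num)).differentiableOn (by norm_num)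
  exact (h.differentiableAt (hs.mem_nhds hx)).clm_apply (differentiableAt_const _)

lemma pdC_vortexPhase_mul (k : ℤ) (i : Fin 3) (a : ℂ) {w : Eu 3 → ℂ} {x : Eu 3}
    (hx : rad x ≠ 0) (hw : DifferentiableAt ℝ w x) :
    pdC i (fun y => a * vortexPhase k y * w y) x
      = a * vortexPhase k x * (Complex.I * (phaseGrad k i x : ℂ) * w x + pdC i w x) := by
  have hP := differentiableAt_vortexPhase k hx
  rw [pdC_mul (hP.const_mul a) hw, pdC_const_mul a hP, pdC_vortexPhase k i hx]
  ring

lemma pdC_pdC_vortexPhase_mul (k : ℤ) (i : Fin 3) (a : ℂ) {v : Eu 3 → ℝ}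
    (hv : ContDiffOn ℝ 2 v {x : Eu 3 | rad x ≠ 0}) {x : Eu 3} (hx : rad x ≠ 0) :
    pdC i (pdC i (fun y => a * vortexPhase k y * (v y : ℂ))) x
      = a * vortexPhase k x * (((pdR i (pdR i v) x - phaseGrad k i x ^ 2 * v x : ℝ) : ℂ)
        + Complex.I * ((2 * (phaseGrad k i x * pdR i v x) + pdR i (phaseGrad k i) x * v x : ℝ)
          : ℂ)) := by
  have hvd : ∀ y : Eu 3, rad y ≠ 0 → DifferentiableAt ℝ v y := fun y hy =>
    (hv.differentiableOn (by norm_num)).differentiableAt (isOpen_rad_ne_zero.mem_nhds hy)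
  have hfirst : pdC i (fun y => a * vortexPhase k y * (v y : ℂ)) =ᶠ[𝓝 x] fun y =>
      a * vortexPhase k y * (Complex.I * (phaseGrad k i y : ℂ) * (v y : ℂ) + (pdR i v y : ℂ)) := by
    filter_upwards [rad_ne_zero_eventually hx] with y hy
    rw [pdC_vortexPhase_mul k i a hy (hvd y hy).complex_ofReal, pdC_ofReal (hvd y hy)]
  have hg := differentiableAt_phaseGrad k i hx
  have hIg := hg.complex_ofReal.const_mul Complex.I
  have hpd := differentiableAt_pdR isOpen_rad_ne_zero hv i hx
  have hmul := hIg.fun_mul (hvd x hx).complex_ofReal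
  rw [pdC_congr hfirst, pdC_vortexPhase_mul k i a hx (hmul.fun_add hpd.complex_ofReal),
    pdC_add hmul hpd.complex_ofReal, pdC_mul hIg (hvd x hx).complex_ofReal,
    pdC_const_mul _ hg.complex_ofReal, pdC_ofReal hg, pdC_ofReal (hvd x hx), pdC_ofReal hpd]
  push_cast
  linear_combination (a * vortexPhase k x * (phaseGrad k i x : ℂ) ^ 2 * (v x : ℂ)) * Complex.I_sq

lemma lapC_vortexPhase_mul (k : ℤ) (a : ℂ) {v : Eu 3 → ℝ}
    (hv : ContDiffOn ℝ 2 v {x : Eu 3 | rad x ≠ 0})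
    (hvcyl : ∀ x y : Eu 3, rad x = rad y → x 2 = y 2 → v x = v y) {x : Eu 3} (hx : rad x ≠ 0) :
    lapC (fun y => a * vortexPhase k y * (v y : ℂ)) x
      = a * vortexPhase k x * ((lapR v x - (k / rad x) ^ 2 * v x : ℝ) : ℂ) := by
  have hvd : DifferentiableAt ℝ v x :=
    (hv.differentiableOn (by norm_num)).differentiableAt (isOpen_rad_ne_zero.mem_nhds hx)
  simp only [lapC, pdC_pdC_vortexPhase_mul k _ a hv hx]
  rw [← Finset.mul_sum, Finset.sum_add_distrib, ← Finset.mul_sum, ← Complex.ofReal_sum,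
    ← Complex.ofReal_sum, Finset.sum_add_distrib, ← Finset.mul_sum, ← Finset.sum_mul,
    sum_phaseGrad_mul_pdR k hvcyl hvd, div_phaseGrad k hx, Finset.sum_sub_distrib,
    ← Finset.sum_mul, sum_phaseGrad_sq k hx, lapR]
  simp

lemma magOp_vortexPhase_mul (ε : ℝ) (k : ℤ) (a : ℂ) {c : ℝ → ℝ} {A : Eu 3 → Eu 3}
    (hAdef : ∀ x : Eu 3,
      A x = toE3 (c (rad x) * (-(x 1) / rad x)) (c (rad x) * (x 0 / rad x)) 0)
    {v : Eu 3 → ℝ} (hv : ContDiffOn ℝ 2 v {x : Eu 3 | rad x ≠ 0})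
    (hvcyl : ∀ x y : Eu 3, rad x = rad y → x 2 = y 2 → v x = v y) {x : Eu 3} (hx : rad x ≠ 0)
    (hc : DifferentiableAt ℝ c (rad x)) :
    magOp ε A (fun y => a * vortexPhase k y * (v y : ℂ)) x
      = a * vortexPhase k x
        * ((-ε ^ 2 * lapR v x + (k * ε / rad x + c (rad x)) ^ 2 * v x : ℝ) : ℂ) := by
  have hvd : DifferentiableAt ℝ v x :=
    (hv.differentiableOn (by norm_num)).differentiableAt (isOpen_rad_ne_zero.mem_nhds hx)
  have hcoord : ∀ (y : Eu 3) (i : Fin 3),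
      A y i = ![y 1, -y 0, 0] i * (-(c (rad y) / rad y)) := by
    intro y i
    rw [hAdef]
    fin_cases i <;> simp [toE3] <;> ring
  have hdiv : ∑ i, pdR i (fun y => A y i) x = 0 := by
    simp only [hcoord]
    exact div_radial_tangential (g := fun t => -(c t / t)) hx
      ((hc.fun_div differentiableAt_id hx).fun_neg)
  have hnorm : ‖A x‖ ^ 2 = c (rad x) ^ 2 := by
    rw [EuclideanSpace.norm_sq_eq]
    simp only [hcoord, Fin.sum_univ_three]
    simp
    field_simp
    simp only [sq_abs, rad_sq]
    ring
  have hAk : ∑ i, A x i * phaseGrad k i x = -(k * c (rad x) / rad x) := by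
    simp only [hcoord, phaseGrad, Fin.sum_univ_three]
    simp
    field_simp
    linear_combination (k * c (rad x)) * rad_sq x
  have hAv : ∑ i, A x i * pdR i v x = 0 := by
    simp only [hcoord, Fin.sum_univ_three]
    simp
    linear_combination (-(c (rad x) / rad x)) * angular_deriv_eq_zero hvcyl hvd
  have hgrad : ∑ i, (A x i : ℂ) * pdC i (fun y => a * vortexPhase k y * (v y : ℂ)) x
      = a * vortexPhase k x * (Complex.I * ((-(k * c (rad x) / rad x) * v x : ℝ) : ℂ)) := by
    have hterm : ∀ i, (A x i : ℂ) * pdC i (fun y => a * vortexPhase k y * (v y : ℂ)) x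
        = a * vortexPhase k x * (Complex.I * ((A x i * phaseGrad k i x * v x : ℝ) : ℂ)
          + ((A x i * pdR i v x : ℝ) : ℂ)) := by
      intro i
      rw [pdC_vortexPhase_mul k i a hx hvd.complex_ofReal, pdC_ofReal hvd]
      push_cast
      ring
    rw [Finset.sum_congr rfl fun i _ => hterm i, ← Finset.mul_sum, Finset.sum_add_distrib,
      ← Finset.mul_sum, ← Complex.ofReal_sum, ← Complex.ofReal_sum, hAv, ← Finset.sum_mul, hAk]
    simp
  rw [magOp, hdiv, hnorm, hgrad, lapC_vortexPhase_mul k a hv hvcyl hx]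
  push_cast
  linear_combination
    (-2 * ε * a * vortexPhase k x * (k * c (rad x) / rad x) * v x : ℂ) * Complex.I_sq

/-- vortex ansatz reduction: for a Lorentz-type potential
`A = c(ρ)e_τ`, the function `u_k = C_k((x₂+ix₁)/ρ)^k v_k` with `v_k` real and
cylindrically symmetric solves `(iε∇+A)²u + Vu = |u|^{p−2}u` off the `x₃`-axis
iff `v_k` solves `−ε²Δv + ((kε/ρ + c(ρ))² + V)v = |C_k|^{p−2}|v|^{p−2}v` there. -/
theorem vortex_ansatz_reduction (p : ℝ) (hp : 2 < p) (ε : ℝ) (hε : 0 < ε) (k : ℤ)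
    (Ck : ℝ) (hCk : Ck ≠ 0)
    (c : ℝ → ℝ) (hc : ContDiff ℝ 1 c)
    (A : Eu 3 → Eu 3)
    (hAdef : ∀ x : Eu 3,
      A x = toE3 (c (rad x) * (-(x 1) / rad x)) (c (rad x) * (x 0 / rad x)) 0)
    (V : Eu 3 → ℝ) (hVcyl : ∀ x y : Eu 3, rad x = rad y → x 2 = y 2 → V x = V y)
    (v : Eu 3 → ℝ) (hv : ContDiffOn ℝ 2 v {x : Eu 3 | rad x ≠ 0})
    (hvcyl : ∀ x y : Eu 3, rad x = rad y → x 2 = y 2 → v x = v y)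
    (u : Eu 3 → ℂ) (hu : ∀ x, u x = (Ck : ℂ) * vortexPhase k x * ((v x : ℝ) : ℂ)) :
    (∀ x : Eu 3, rad x ≠ 0 →
        magOp ε A u x + ((V x : ℝ) : ℂ) * u x = ((‖u x‖ ^ (p - 2) : ℝ) : ℂ) * u x)
      ↔ (∀ x : Eu 3, rad x ≠ 0 →
        -ε ^ 2 * lapR v x + (((k : ℝ) * ε / rad x + c (rad x)) ^ 2 + V x) * v x
          = |Ck| ^ (p - 2) * |v x| ^ (p - 2) * v x) := by
  obtain rfl : u = fun y => (Ck : ℂ) * vortexPhase k y * (v y : ℂ) := funext hu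
  refine forall₂_congr fun x hx => ?_
  have hne : (Ck : ℂ) * vortexPhase k x ≠ 0 :=
    mul_ne_zero (Complex.ofReal_ne_zero.2 hCk) (vortexPhase_ne_zero k hx)
  have hnorm : ‖(Ck : ℂ) * vortexPhase k x * (v x : ℂ)‖ ^ (p - 2)
      = |Ck| ^ (p - 2) * |v x| ^ (p - 2) := by
    rw [norm_mul, norm_mul, norm_vortexPhase k hx, Complex.norm_real, Complex.norm_real, mul_one,
      Real.norm_eq_abs, Real.norm_eq_abs, Real.mul_rpow (abs_nonneg _) (abs_nonneg _)]
  rw [magOp_vortexPhase_mul ε k Ck hAdef hv hvcyl hx (hc.differentiable (by norm_num) _), hnorm,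
    ← Complex.ofReal_inj, ← mul_right_inj' (b := ((_ : ℝ) : ℂ)) hne]
  push_cast
  constructor <;> intro h <;> linear_combination h

end
end
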